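/- The polynomial t⁸ + 600822t⁷ + 71378609t⁶ + 4219381768t⁵ + 85080645104t⁴ − 2272444082944t³ + 16480136388352t² − 50330309965824t + 56693912375296 is irreducible over ℚ with Galois group S₈; in particular its roots are not expressible by radicals. -/

import Mathlib

open NumberField in
lemma frob (K : Type)  [Field K] [NumberField K] [IsGalois ℚ K] (p : ℕ) [hp : Fact p.Prime] :
    ∃ (k : Type) (_ : Field k) (_ : CharP k p) (π : 𝓞 K →+* k) (σ : K ≃ₐ[ℚ] K),
      ∀ x y : 𝓞 K, (y : K) = σ x → π y = π x ^ p := by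
  have hP : (Ideal.span {(p : ℤ)}).IsMaximal := by
    apply PrincipalIdealRing.isMaximal_of_irreducible
    exact (Nat.prime_iff_prime_int.mp hp.out).irreducible
  obtain ⟨Q, hQ, hQP⟩ := Ideal.exists_ideal_over_maximal_of_isIntegral (S := 𝓞 K) (Ideal.span {(p : ℤ)})
    (by
      have : RingHom.ker (algebraMap ℤ (𝓞 K)) = ⊥ := by
        rw [← RingHom.injective_iff_ker_eq_bot]; exact (algebraMap ℤ (𝓞 K)).injective_int
      rw [this]; exact bot_le)
  have hpQ : (p : 𝓞 K) ∈ Q := by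
    have : (p : ℤ) ∈ Q.comap (algebraMap ℤ (𝓞 K)) := by
      rw [hQP]; exact Ideal.mem_span_singleton_self _
    simpa using this
  have hQ0 : Q ≠ ⊥ := by
    rintro rfl
    have : (p : 𝓞 K) = 0 := by simpa using hpQ
    exact hp.out.ne_zero (by exact_mod_cast this)
  have : Finite (𝓞 K ⧸ Q) := Ideal.finiteQuotientOfFreeOfNeBot Q hQ0
  obtain ⟨σ, hσ⟩ := IsArithFrobAt.exists_of_isInvariant ℤ (K ≃ₐ[ℚ] K) Q
  let _ : Field (𝓞 K ⧸ Q) := Ideal.Quotient.field Q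
  have hc : CharP (𝓞 K ⧸ Q) p := by
    obtain ⟨q, hq⟩ := CharP.exists (𝓞 K ⧸ Q)
    have h0 : ((p : ℕ) : 𝓞 K ⧸ Q) = 0 := by
      have := Ideal.Quotient.eq_zero_iff_mem.mpr hpQ
      simpa using this
    have hd := (CharP.cast_eq_zero_iff (𝓞 K ⧸ Q) q p).mp h0
    rcases (Nat.dvd_prime hp.out).mp hd with h | h
    · exact absurd h (CharP.char_ne_one (𝓞 K ⧸ Q) q)
    · rw [← h]; exact hq
  refine ⟨𝓞 K ⧸ Q, inferInstance, hc, Ideal.Quotient.mk Q, σ, fun x y hxy => ?_⟩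
  have hy : y = σ • x := by
    apply NumberField.RingOfIntegers.ext
    rw [hxy]; rfl
  have := hσ.mk_apply x
  have hcard : Nat.card (ℤ ⧸ Q.under ℤ) = p := by
    have : Q.under ℤ = Ideal.span {(p : ℤ)} := hQP
    rw [this]
    rw [Nat.card_congr (Int.quotientSpanNatEquivZMod p).toEquiv, Nat.card_zmod]
  rw [hcard] at this
  rw [hy]; exact this
def F {R : Type*} [CommRing R] (y : R) : R := y^8 + 600822*y^7 + 71378609*y^6 + 4219381768*y^5 + 85080645104*y^4 - 2272444082944*y^3 + 16480136388352*y^2 - 50330309965824*y + 56693912375296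

def F' {R : Type*} [CommRing R] (y : R) : R := 8*y^7 + 4205754*y^6 + 428271654*y^5 + 21096908840*y^4 + 340322580416*y^3 - 6817332248832*y^2 + 32960272776704*y - 50330309965824

lemma sep5 {k : Type*} [CommRing k] (hk : (5 : k) = 0) (y : k) (h : F y = 0) (h' : F' y = 0) :
    (1 : k) = 0 := by
  unfold F at h
  unfold F' at h'
  linear_combination (y^6 + y^4 + y^3 + 1) * h + (- 2*y^7 + 2*y^6 + 2*y^4 - 2*y^3 + 2*y^2 - y) * h' - (- 3*y^14 - 1562134*y^13 - 155350638*y^12 - 7423458353*y^11 - 110658061425*y^10 + 2409600893549*y^9 - 12588885589995*y^8 + 22940559272584*y^7 - 8806497596961*y^6 + 9273760821472*y^5 - 34821493901712*y^4 + 45563993205248*y^3 - 23428151264000*y^2 + 11338782475059) * hk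

lemma fac5 {k : Type*} [CommRing k] (hk : (5 : k) = 0) (y : k) :
    F y = (y - 4) * (y^7 + y^6 - 2*y^5 - y^3 + 2*y^2 + 1) := by
  unfold F
  linear_combination (120165*y^7 + 14275723*y^6 + 843876352*y^5 + 17016129021*y^4 - 454488816590*y^3 + 3296027277672*y^2 - 10066061993165*y + 11338782475060) * hk

lemma nofix5 {k : Type*} [CommRing k] (hk : (5 : k) = 0) (y : k) (h : y^7 + y^6 - 2*y^5 - y^3 + 2*y^2 + 1 = 0) (h' : y^5 = y) :
    (1 : k) = 0 := by
  linear_combination (- 2*y^4 + y^3 - 2*y^2 + 1) * h + (2*y^6 + y^5 + 2*y^4 - y^3) * h' - (y^9 - y^8 + y^7 - y^6 - y^4) * hk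

lemma per5 {k : Type*} [CommRing k] (hk : (5 : k) = 0) (y : k) (h : y^7 + y^6 - 2*y^5 - y^3 + 2*y^2 + 1 = 0) :
    y^(5^7) = y := by
  have e1 : y^5 = y^5 := rfl
  have e2 : y^25 = y^6 + y^5 + y^3 + 2*y^2 + y - 1 := by
    calc y^25 = (y^5)^5 := by rw [← pow_mul]
      _ = (y^5)^5 := by rw [e1]
      _ = y^6 + y^5 + y^3 + 2*y^2 + y - 1 := by
        linear_combination (y^18 - y^17 - 2*y^16 + 2*y^14 - y^12 - y^11 + 2*y^10 - y^9 - y^8 - 2*y^7 - y^6 - 2*y^5 + 2*y^4 + 2*y^3 + y^2 - y + 1) * h + (y^23 - y^21 - y^20 + y^19 + y^18 - y^16 + y^15 + y^13 - y^12 - 2*y^10 + y^9 + y^8 + 2*y^7 - y^6 - y^4 - y^2) * hk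
  have e3 : y^125 = - 2*y^6 + y^5 - 2*y^4 + y^3 - 2*y^2 + 2*y - 2 := by
    calc y^125 = (y^25)^5 := by rw [← pow_mul]
      _ = (y^6 + y^5 + y^3 + 2*y^2 + y - 1)^5 := by rw [e2]
      _ = - 2*y^6 + y^5 - 2*y^4 + y^3 - 2*y^2 + 2*y - 2 := by
        linear_combination (y^23 - y^22 - 2*y^21 + 2*y^19 + y^18 - 2*y^17 + 2*y^16 + 2*y^15 + y^14 - y^13 + 2*y^12 - 2*y^11 + y^9 + 2*y^8 - 2*y^7 + y^6 - y^5 - y^3 - 2*y + 1) * h + (y^29 + 3*y^28 + 3*y^27 + 6*y^26 + 14*y^25 + 22*y^24 + 26*y^23 + 41*y^22 + 65*y^21 + 65*y^20 + 59*y^19 + 82*y^18 + 102*y^17 + 58*y^16 + 24*y^15 + 49*y^14 + 55*y^13 - 12*y^12 - 37*y^11 + 4*y^10 + 18*y^9 - 21*y^8 - 22*y^7 + 8*y^6 + 16*y^5 - y^4 - 4*y^3 + y) * hk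
  have e4 : y^625 = - y^6 - 2*y^4 + 2*y^3 + y^2 - y + 2 := by
    calc y^625 = (y^125)^5 := by rw [← pow_mul]
      _ = (- 2*y^6 + y^5 - 2*y^4 + y^3 - 2*y^2 + 2*y - 2)^5 := by rw [e3]
      _ = - y^6 - 2*y^4 + 2*y^3 + y^2 - y + 2 := by
        linear_combination (- 2*y^23 + 2*y^22 - y^21 + y^19 + y^18 + y^17 + y^15 - y^14 + y^10 + y^9 + y^8 + 2*y^7 + y^6 + 2*y^5 - y^4 + 2*y^3 + 2*y^2 + y + 1) * h + (- 6*y^30 + 16*y^29 - 49*y^28 + 89*y^27 - 179*y^26 + 297*y^25 - 507*y^24 + 754*y^23 - 1110*y^22 + 1492*y^21 - 1988*y^20 + 2473*y^19 - 3006*y^18 + 3428*y^17 - 3814*y^16 + 4032*y^15 - 4154*y^14 + 4058*y^13 - 3826*y^12 + 3424*y^11 - 2966*y^10 + 2438*y^9 - 1920*y^8 + 1407*y^7 - 975*y^6 + 630*y^5 - 384*y^4 + 207*y^3 - 97*y^2 + 32*y - 7) * hk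
  have e5 : y^3125 = 2*y^6 + 2*y^5 + y^4 - y^3 + y^2 + y + 2 := by
    calc y^3125 = (y^625)^5 := by rw [← pow_mul]
      _ = (- y^6 - 2*y^4 + 2*y^3 + y^2 - y + 2)^5 := by rw [e4]
      _ = 2*y^6 + 2*y^5 + y^4 - y^3 + y^2 + y + 2 := by
        linear_combination (- y^23 + y^22 + 2*y^21 - 2*y^19 + y^17 + y^16 - 2*y^15 + y^14 - y^13 - y^12 + 2*y^10 - y^9 - y^7 - y^6 - 2*y^3 - y^2 - y) * h + (- 3*y^28 + 2*y^27 - 6*y^26 + 16*y^25 - 15*y^24 + 31*y^23 - 18*y^22 - 3*y^21 + 27*y^20 - 107*y^19 + 125*y^18 - 138*y^17 + 57*y^16 + 110*y^15 - 221*y^14 + 325*y^13 - 217*y^12 - 10*y^11 + 243*y^10 - 348*y^9 + 194*y^8 + 8*y^7 - 156*y^6 + 144*y^5 - 54*y^4 - 7*y^3 + 32*y^2 - 16*y + 6) * hk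
  have e6 : y^15625 = - 2*y^4 + 2*y^3 - 2*y^2 + y - 2 := by
    calc y^15625 = (y^3125)^5 := by rw [← pow_mul]
      _ = (2*y^6 + 2*y^5 + y^4 - y^3 + y^2 + y + 2)^5 := by rw [e5]
      _ = - 2*y^4 + 2*y^3 - 2*y^2 + y - 2 := by
        linear_combination (2*y^23 - 2*y^22 + y^21 - y^19 + 2*y^18 + y^17 - y^16 - y^15 + 2*y^14 - y^13 - 2*y^12 - y^11 - y^9 + y^8 - 2*y^7 + 2*y^6 - 2*y^4 - y^3 - y^2 - y - 1) * h + (6*y^30 + 32*y^29 + 81*y^28 + 111*y^27 + 97*y^26 + 69*y^25 + 152*y^24 + 328*y^23 + 443*y^22 + 338*y^21 + 203*y^20 + 268*y^19 + 553*y^18 + 665*y^17 + 502*y^16 + 232*y^15 + 261*y^14 + 430*y^13 + 528*y^12 + 339*y^11 + 166*y^10 + 100*y^9 + 188*y^8 + 185*y^7 + 133*y^6 + 40*y^5 + 27*y^4 + 24*y^3 + 33*y^2 + 16*y + 7) * hk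
  have e7 : y^78125 = y := by
    calc y^78125 = (y^15625)^5 := by rw [← pow_mul]
      _ = (- 2*y^4 + 2*y^3 - 2*y^2 + y - 2)^5 := by rw [e6]
      _ = y := by
        linear_combination (- 2*y^13 + 2*y^12 - y^11 + y^9 + 2*y^8 - 2*y^6 + y^5 + y^4 - y^2 - y - 2) * h + (- 6*y^20 + 32*y^19 - 97*y^18 + 209*y^17 - 385*y^16 + 615*y^15 - 881*y^14 + 1122*y^13 - 1312*y^12 + 1399*y^11 - 1383*y^10 + 1240*y^9 - 1041*y^8 + 794*y^7 - 562*y^6 + 351*y^5 - 210*y^4 + 104*y^3 - 47*y^2 + 16*y - 6) * hk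
  norm_num only
  exact e7

lemma sep601 {k : Type*} [CommRing k] (hk : (601 : k) = 0) (y : k) (h : F y = 0) (h' : F' y = 0) :
    (1 : k) = 0 := by
  unfold F at h
  unfold F' at h'
  linear_combination (191*y^6 + 148*y^5 + 55*y^4 + 201*y^3 + 120*y^2 - 82*y + 39) * h + (- 99*y^7 + 231*y^6 + 120*y^5 + 23*y^4 + 128*y^3 + 233*y^2 - 217*y - 82) * h' - (- y^14 - 501848*y^13 - 46098382*y^12 - 1951180591*y^11 - 19780602133*y^10 + 557194720777*y^9 - 3293794748467*y^8 + 7500264209332*y^7 - 6556272577523*y^6 + 4286267245220*y^5 - 5713232562688*y^4 + 10989619328128*y^3 - 11226688766720*y^2 + 2674129769472*y + 10546003327511) * hk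

lemma fac601 {k : Type*} [CommRing k] (hk : (601 : k) = 0) (y : k) :
    F y = (y - 140) * (y - 239) * (y - 363) * (y - 422) * (y - 513) * (y - 586) * (y^2 + 282*y - 34) := by
  unfold F
  linear_combination (1003*y^7 + 116394*y^6 + 7659881*y^5 + 190204320*y^4 - 66466371150*y^3 + 12014798006472*y^2 - 724830377605272*y + 87263809328416) * hk

lemma nofix601 {k : Type*} [CommRing k] (hk : (601 : k) = 0) (y : k) (h : y^2 + 282*y - 34 = 0) (h' : y^601 = y) :
    (1 : k) = 0 := by
  have e1 : y^1 = y := pow_one y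
  have e2 : y^2 = - 282*y + 34 := by
    calc y^2 = (y^1)^2 := by ring
      _ = (y)^2 := by rw [e1]
      _ = - 282*y + 34 := by
        linear_combination (1) * h + (0) * hk
  have e4 : y^4 = 2*y - 129 := by
    calc y^4 = (y^2)^2 := by ring
      _ = (- 282*y + 34)^2 := by rw [e2]
      _ = 2*y - 129 := by
        linear_combination (192) * h + (132*y^2 - 122*y + 13) * hk
  have e9 : y^9 = 186*y - 3 := by
    calc y^9 = (y^4)^2 * y := by ring
      _ = (2*y - 129)^2 * y := by rw [e4]
      _ = 186*y - 3 := by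
        linear_combination (4*y + 159) * h + (- 3*y^2 - 47*y + 9) * hk
  have e18 : y^18 = 47*y + 116 := by
    calc y^18 = (y^9)^2 := by ring
      _ = (186*y - 3)^2 := by rw [e9]
      _ = 47*y + 116 := by
        linear_combination (- 262) * h + (58*y^2 + 121*y - 15) * hk
  have e37 : y^37 = - 175*y - 132 := by
    calc y^37 = (y^18)^2 * y := by ring
      _ = (47*y + 116)^2 * y := by rw [e18]
      _ = - 175*y - 132 := by
        linear_combination (- 195*y - 216) * h + (4*y^3 + 110*y^2 + 113*y - 12) * hk
  have e75 : y^75 = 207*y + 260 := by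
    calc y^75 = (y^37)^2 * y := by ring
      _ = (- 175*y - 132)^2 * y := by rw [e37]
      _ = 207*y + 260 := by
        linear_combination (- 26*y + 43) * h + (51*y^3 + 89*y^2 + 7*y + 2) * hk
  have e150 : y^150 = - 252*y - 271 := by
    calc y^150 = (y^75)^2 := by ring
      _ = (207*y + 260)^2 := by rw [e75]
      _ = - 252*y - 271 := by
        linear_combination (178) * h + (71*y^2 + 96*y + 123) * hk
  have e300 : y^300 = 26*y - 138 := by
    calc y^300 = (y^150)^2 := by ring
      _ = (- 252*y - 271)^2 := by rw [e150]
      _ = 26*y - 138 := by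
        linear_combination (- 202) * h + (106*y^2 + 322*y + 111) * hk
  have e601 : y^601 = - y - 282 := by
    calc y^601 = (y^300)^2 * y := by ring
      _ = (26*y - 138)^2 * y := by rw [e300]
      _ = - y - 282 := by
        linear_combination (75*y - 79) * h + (y^3 - 47*y^2 + 73*y - 4) * hk
  have h2 : - 2*y - 282 = 0 := by linear_combination h' - e601
  linear_combination (- 22) * h + (- 11*y + 252) * h2 - (- 6*y - 117) * hk

def G {R : Type*} [CommRing R] (x y : R) : R := (-50330309965824) * (x^0*y^0)
      + (16480136388352) * (x^0*y^1 + x^1*y^0)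
      + (-2272444082944) * (x^0*y^2 + x^1*y^1 + x^2*y^0)
      + (85080645104) * (x^0*y^3 + x^1*y^2 + x^2*y^1 + x^3*y^0)
      + (4219381768) * (x^0*y^4 + x^1*y^3 + x^2*y^2 + x^3*y^1 + x^4*y^0)
      + (71378609) * (x^0*y^5 + x^1*y^4 + x^2*y^3 + x^3*y^2 + x^4*y^1 + x^5*y^0)
      + (600822) * (x^0*y^6 + x^1*y^5 + x^2*y^4 + x^3*y^3 + x^4*y^2 + x^5*y^1 + x^6*y^0)
      + (1) * (x^0*y^7 + x^1*y^6 + x^2*y^5 + x^3*y^4 + x^4*y^3 + x^5*y^2 + x^6*y^1 + x^7*y^0)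

lemma F_sub {R : Type*} [CommRing R] (x y : R) : F x - F y = (x - y) * G x y := by
  unfold F G; ring

lemma G_self {R : Type*} [CommRing R] (x : R) : G x x = F' x := by
  unfold F' G; ring

lemma map_F {R S : Type*} [CommRing R] [CommRing S] (π : R →+* S) (x : R) : π (F x) = F (π x) := by
  simp only [F, map_add, map_sub, map_mul, map_pow, map_ofNat]

lemma map_G {R S : Type*} [CommRing R] [CommRing S] (π : R →+* S) (x y : R) :
    π (G x y) = G (π x) (π y) := by
  simp only [G, map_add, map_mul, map_pow, map_ofNat, map_neg, map_one]

lemma red_inj {R S : Type*} [CommRing R] [IsDomain R] [CommRing S] (π : R →+* S) (x y : R)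
    (hx : F x = 0) (hy : F y = 0) (h : π x = π y) (hS : F' (π x) ≠ 0) : x = y := by
  by_contra hne
  have h1 : (x - y) * G x y = 0 := by rw [← F_sub, hx, hy, sub_zero]
  have h2 : G x y = 0 := (mul_eq_zero.mp h1).resolve_left (sub_ne_zero.mpr hne)
  apply hS
  rw [← G_self]
  nth_rewrite 2 [h]
  rw [← map_G, h2, map_zero]

lemma comb7 {Ω : Type*} [Fintype Ω] [DecidableEq Ω] (hc : Fintype.card Ω = 8) (σ : Equiv.Perm Ω)
    (h7 : ∀ x, (σ ^ 7) x = x) (hfix : ∀ x y, σ x = x → σ y = y → x = y) :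
    ∃ x₀, σ x₀ = x₀ ∧ ∀ s t, s ≠ x₀ → t ≠ x₀ → ∃ i : ℕ, (σ ^ i) s = t := by
  have : Fact (Nat.Prime 7) := ⟨by norm_num⟩
  have hex : ∃ x₀, σ x₀ = x₀ := by
    have hs : σ ^ 7 ^ 1 = 1 := by ext x; simpa using h7 x
    have h8 : ¬ 7 ∣ Fintype.card Ω := by rw [hc]; norm_num
    exact Equiv.Perm.exists_fixed_point_of_prime h8 hs
  obtain ⟨x₀, hx₀⟩ := hex
  refine ⟨x₀, hx₀, fun s t hs ht => ?_⟩
  have hper : Function.IsPeriodicPt σ 7 s := by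
    have := h7 s
    rwa [Equiv.Perm.coe_pow] at this
  have hmp : Function.minimalPeriod σ s = 7 := by
    rcases (Nat.dvd_prime this.out).mp hper.minimalPeriod_dvd with h | h
    · exact absurd (hfix s x₀ (Function.minimalPeriod_eq_one_iff_isFixedPt.mp h) hx₀) hs
    · exact h
  have hne : ∀ i : ℕ, (σ ^ i) s ≠ x₀ := by
    intro i hi
    apply hs
    have h2 : (σ ^ i) x₀ = x₀ := by
      rw [Equiv.Perm.coe_pow]; exact Function.iterate_fixed hx₀ i
    exact (σ ^ i).injective (hi.trans h2.symm)
  have himg : (Finset.range 7).image (fun i => (σ ^ i) s) = Finset.univ.erase x₀ := by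
    apply Finset.eq_of_subset_of_card_le
    · intro z hz
      obtain ⟨i, -, rfl⟩ := Finset.mem_image.mp hz
      exact Finset.mem_erase.mpr ⟨hne i, Finset.mem_univ _⟩
    · rw [Finset.card_erase_of_mem (Finset.mem_univ _), Finset.card_univ, hc,
        Finset.card_image_of_injOn]
      · simp
      · intro i hi j hj hij
        simp only [Equiv.Perm.coe_pow] at hij
        have hi' : i < 7 := by simpa using hi
        have hj' : j < 7 := by simpa using hj
        exact (Function.iterate_eq_iterate_iff_of_lt_minimalPeriod (hmp ▸ hi') (hmp ▸ hj')).mp hij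
  have ht' : t ∈ (Finset.range 7).image (fun i => (σ ^ i) s) := by
    rw [himg]; exact Finset.mem_erase.mpr ⟨ht, Finset.mem_univ _⟩
  obtain ⟨i, -, hi⟩ := Finset.mem_image.mp ht'
  exact ⟨i, hi⟩

lemma comb_swap {Ω : Type*} [Fintype Ω] [DecidableEq Ω] (τ : Equiv.Perm Ω) (a : Ω) (ha : τ a ≠ a)
    (h3 : ∀ x y z, τ x ≠ x → τ y ≠ y → τ z ≠ z → x ≠ y → x ≠ z → y = z) :
    τ = Equiv.swap a (τ a) := by
  have ha2 : τ (τ a) ≠ τ a := fun h => ha (τ.injective h)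
  have ha3 : τ (τ a) = a := by
    by_contra h
    have := h3 a (τ a) (τ (τ a)) ha ha2 (fun h => ha2 (τ.injective h)) ha.symm (Ne.symm h)
    exact ha2 this.symm
  ext x
  by_cases hxa : x = a
  · rw [hxa, Equiv.swap_apply_left]
  by_cases hxb : x = τ a
  · rw [hxb, Equiv.swap_apply_right, ha3]
  rw [Equiv.swap_apply_of_ne_of_ne hxa hxb]
  by_contra h
  exact hxb (h3 a x (τ a) ha h ha2 (Ne.symm hxa) ha.symm)

lemma comb_top {Ω : Type*} [Fintype Ω] [DecidableEq Ω] (H : Subgroup (Equiv.Perm Ω))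
    (σ : Equiv.Perm Ω) (hσ : σ ∈ H) (x₀ : Ω) (hx₀ : σ x₀ = x₀)
    (htr : ∀ s t, s ≠ x₀ → t ≠ x₀ → ∃ i : ℕ, (σ ^ i) s = t)
    (hmove : ∃ g ∈ H, g x₀ ≠ x₀) (a b : Ω) (hab : a ≠ b) (hsw : Equiv.swap a b ∈ H) :
    (∀ x, ∃ g ∈ H, g x₀ = x) ∧ H = ⊤ := by
  have hT : ∀ x, ∃ g ∈ H, g x₀ = x := by
    intro x
    by_cases hx : x = x₀
    · exact ⟨1, H.one_mem, by simp [hx]⟩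
    obtain ⟨g, hg, hgx⟩ := hmove
    obtain ⟨i, hi⟩ := htr (g x₀) x hgx hx
    exact ⟨σ ^ i * g, H.mul_mem (H.pow_mem hσ i) hg, by simpa using hi⟩
  refine ⟨hT, ?_⟩
  have hconj : ∀ g ∈ H, ∀ u v, Equiv.swap u v ∈ H → Equiv.swap (g u) (g v) ∈ H := by
    intro g hg u v h
    rw [Equiv.swap_apply_apply]
    exact H.mul_mem (H.mul_mem hg h) (H.inv_mem hg)
  obtain ⟨g, hg, hga⟩ := hT a
  have h1 : Equiv.swap x₀ (g⁻¹ b) ∈ H := by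
    have := hconj g⁻¹ (H.inv_mem hg) a b hsw
    rwa [show g⁻¹ a = x₀ by rw [← hga]; simp] at this
  have hb : g⁻¹ b ≠ x₀ := by
    intro h
    apply hab
    rw [← hga, ← h]; simp
  have h2 : ∀ t, t ≠ x₀ → Equiv.swap x₀ t ∈ H := by
    intro t ht
    obtain ⟨i, hi⟩ := htr _ t hb ht
    have := hconj (σ ^ i) (H.pow_mem hσ i) _ _ h1
    have h3 : (σ ^ i) x₀ = x₀ := by
      rw [Equiv.Perm.coe_pow]; exact Function.iterate_fixed hx₀ i
    rwa [hi, h3] at this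
  have h3 : ∀ u v, u ≠ v → Equiv.swap u v ∈ H := by
    intro u v huv
    by_cases hu : u = x₀
    · rw [hu]; exact h2 v (fun h => huv (hu.trans h.symm))
    by_cases hv : v = x₀
    · rw [hv, Equiv.swap_comm]; exact h2 u hu
    have := hconj _ (h2 u hu) _ _ (h2 v hv)
    rwa [Equiv.swap_apply_left, Equiv.swap_apply_of_ne_of_ne hv huv.symm] at this
  rw [eq_top_iff, ← Equiv.Perm.closure_isSwap, Subgroup.closure_le]
  rintro τ ⟨u, v, huv, rfl⟩
  exact h3 u v huv

open Polynomial NumberField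

lemma no_int_root (n : ℤ) : F n ≠ 0 := by
  intro h
  have h1 : F ((Int.castRingHom (ZMod 3)) n) = 0 := by rw [← map_F, h, map_zero]
  have h2 : ∀ z : ZMod 3, F z ≠ 0 := by unfold F; decide
  exact h2 _ h1

noncomputable def fZ : ℤ[X] := X ^ 8 + C 600822 * X ^ 7 + C 71378609 * X ^ 6 + C 4219381768 * X ^ 5
      + C 85080645104 * X ^ 4 - C 2272444082944 * X ^ 3 + C 16480136388352 * X ^ 2
      - C 50330309965824 * X + C 56693912375296

lemma fZ_aeval {R : Type*} [CommRing R] (x : R) : aeval x fZ = F x := by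
  simp only [fZ, F, map_add, map_sub, map_mul, map_pow, aeval_X, map_ofNat]

lemma fZ_monic : fZ.Monic := by
  unfold fZ
  monicity!

lemma fZ_deg : fZ.natDegree = 8 := by
  unfold fZ
  compute_degree!

/-- A Frobenius element acting on a set with a lift to the ring of integers. -/
lemma frobPerm (K : Type) [Field K] [NumberField K] [IsGalois ℚ K] (p : ℕ) [Fact p.Prime]
    (hsep : ∀ (k : Type) [Field k] (_ : (p : k) = 0) (y : k), F y = 0 → F' y ≠ 0)
    (Ω : Type) (c : Ω → K) (hc : Function.Injective c) (hF : ∀ x, F (c x) = 0)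
    (ρ : (K ≃ₐ[ℚ] K) → Equiv.Perm Ω) (hρ : ∀ g x, c (ρ g x) = g (c x)) :
    ∃ (k : Type) (_ : Field k) (_ : CharP k p) (φ : Ω → k) (g : K ≃ₐ[ℚ] K),
      Function.Injective φ ∧ (∀ x, F (φ x) = 0) ∧ ∀ x, φ (ρ g x) = φ x ^ p := by
  obtain ⟨k, _, hk, π, σ, hσ⟩ := frob K p
  have hint : ∀ x, IsIntegral ℤ (c x) := fun x =>
    ⟨fZ, fZ_monic, by rw [← aeval_def, fZ_aeval, hF]⟩
  let l : Ω → 𝓞 K := fun x => ⟨c x, hint x⟩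
  have hl : ∀ x, F (l x) = 0 := by
    intro x
    apply RingOfIntegers.coe_injective
    rw [map_zero]
    exact (map_F (algebraMap (𝓞 K) K) (l x)).trans (hF x)
  have hp0 : ((p : ℕ) : k) = 0 := CharP.cast_eq_zero k p
  have hφ : ∀ x, F (π (l x)) = 0 := fun x => by rw [← map_F, hl, map_zero]
  refine ⟨k, inferInstance, hk, fun x => π (l x), σ, ?_, hφ, ?_⟩
  · intro x y hxy
    have := red_inj π (l x) (l y) (hl x) (hl y) hxy (hsep k hp0 _ (hφ x))
    apply hc
    exact congrArg (algebraMap (𝓞 K) K) this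
  · intro x
    exact hσ (l x) (l (ρ σ x)) (hρ σ x)

lemma deriv_ne_zero (K : Type) [Field K] [NumberField K] [IsGalois ℚ K] (x : K) (hx : F x = 0) :
    F' x ≠ 0 := by
  have : Fact (Nat.Prime 5) := ⟨by norm_num⟩
  obtain ⟨k, _, hk, π, σ, hσ⟩ := frob K 5
  have h5 : (5 : k) = 0 := by exact_mod_cast CharP.cast_eq_zero k 5
  intro hx'
  let l : 𝓞 K := ⟨x, fZ, fZ_monic, by rw [← aeval_def, fZ_aeval, hx]⟩
  have hl : F l = 0 := by
    apply RingOfIntegers.coe_injective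
    rw [map_zero]
    exact (map_F (algebraMap (𝓞 K) K) l).trans hx
  have hl' : G l l = 0 := by
    apply RingOfIntegers.coe_injective
    rw [map_zero]
    exact (map_G (algebraMap (𝓞 K) K) l l).trans ((G_self x).trans hx')
  apply one_ne_zero (α := k)
  apply sep5 h5 (π l)
  · rw [← map_F, hl, map_zero]
  · rw [← G_self, ← map_G, hl', map_zero]

lemma perm5 {k Ω : Type} [Field k] [CharP k 5] [Fintype Ω] [DecidableEq Ω]
    (hcard : Fintype.card Ω = 8) (φ : Ω → k) (hφ : Function.Injective φ) (hF : ∀ x, F (φ x) = 0)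
    (σ : Equiv.Perm Ω) (hσ : ∀ x, φ (σ x) = φ x ^ 5) :
    ∃ x₀, σ x₀ = x₀ ∧ ∀ s t, s ≠ x₀ → t ≠ x₀ → ∃ i : ℕ, (σ ^ i) s = t := by
  have h5 : (5 : k) = 0 := by exact_mod_cast CharP.cast_eq_zero k 5
  have hpow : ∀ (i : ℕ) x, φ ((σ ^ i) x) = φ x ^ 5 ^ i := by
    intro i x
    induction i with
    | zero => simp
    | succ n ih => rw [pow_succ', Equiv.Perm.mul_apply, hσ, ih, ← pow_mul, pow_succ]
  have h4 : ((4 : k)) ^ 5 = 4 := by linear_combination 204 * h5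
  apply comb7 hcard
  · intro x
    apply hφ
    rw [hpow]
    have := hF x
    rw [fac5 h5] at this
    rcases mul_eq_zero.mp this with h | h
    · rw [sub_eq_zero.mp h]
      have : ∀ n : ℕ, (4 : k) ^ 5 ^ n = 4 := by
        intro n
        induction n with
        | zero => simp
        | succ n ih => rw [pow_succ, pow_mul, ih, h4]
      exact this 7
    · exact per5 h5 _ h
  · have key : ∀ x, σ x = x → φ x = 4 := by
      intro x hx
      have h1 : φ x ^ 5 = φ x := by rw [← hσ, hx]
      have := hF x
      rw [fac5 h5] at this
      rcases mul_eq_zero.mp this with h | h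
      · exact sub_eq_zero.mp h
      · exact absurd (nofix5 h5 _ h h1) one_ne_zero
    intro x y hx hy
    exact hφ ((key x hx).trans (key y hy).symm)

lemma perm601 {k Ω : Type} [Field k] [CharP k 601] [Fintype Ω] [DecidableEq Ω]
    (hcard : Fintype.card Ω = 8) (φ : Ω → k) (hφ : Function.Injective φ) (hF : ∀ x, F (φ x) = 0)
    (σ : Equiv.Perm Ω) (hσ : ∀ x, φ (σ x) = φ x ^ 601) :
    ∃ a b, a ≠ b ∧ σ = Equiv.swap a b := by
  classical
  have : Fact (Nat.Prime 601) := ⟨by norm_num⟩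
  have hp : (601 : k) = 0 := by exact_mod_cast CharP.cast_eq_zero k 601
  let A : Finset k := {140, 239, 363, 422, 513, 586}
  have hA : ∀ y ∈ A, y ^ 601 = y := by
    have hn : ∀ n : ℕ, (n : k) ^ 601 = n := fun n => by
      rw [← frobenius_def, map_natCast]
    intro y hy
    simp only [A, Finset.mem_insert, Finset.mem_singleton] at hy
    rcases hy with rfl | rfl | rfl | rfl | rfl | rfl
    · exact_mod_cast hn 140
    · exact_mod_cast hn 239
    · exact_mod_cast hn 363
    · exact_mod_cast hn 422
    · exact_mod_cast hn 513
    · exact_mod_cast hn 586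
  have hq : ∀ x, φ x ∈ A ∨ φ x ^ 2 + 282 * φ x - 34 = 0 := by
    intro x
    have := hF x
    rw [fac601 hp] at this
    simp only [mul_eq_zero, sub_eq_zero (b := (140 : k)), sub_eq_zero (b := (239 : k)),
      sub_eq_zero (b := (363 : k)), sub_eq_zero (b := (422 : k)), sub_eq_zero (b := (513 : k)),
      sub_eq_zero (b := (586 : k))] at this
    simp only [A, Finset.mem_insert, Finset.mem_singleton]
    rcases this with (((((h | h) | h) | h) | h) | h) | h <;> simp only [h, true_or, or_true]
  have hmoved : ∀ x, σ x ≠ x → φ x ^ 2 + 282 * φ x - 34 = 0 := by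
    intro x hx
    refine (hq x).resolve_left fun h => hx (hφ ?_)
    rw [hσ, hA _ h]
  obtain ⟨a, ha⟩ : ∃ a, φ a ∉ A := by
    by_contra hcon
    push Not at hcon
    have h1 : (Finset.univ.image φ).card ≤ A.card :=
      Finset.card_le_card (by
        intro y hy
        obtain ⟨x, -, rfl⟩ := Finset.mem_image.mp hy
        exact hcon x)
    rw [Finset.card_image_of_injective _ hφ, Finset.card_univ, hcard] at h1
    have h2 : A.card ≤ 6 := Finset.card_le_six
    omega
  have ham : σ a ≠ a := by
    intro h
    have h1 : φ a ^ 601 = φ a := by rw [← hσ, h]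
    exact one_ne_zero (nofix601 hp _ ((hq a).resolve_left ha) h1)
  refine ⟨a, σ a, ham.symm, comb_swap σ a ham ?_⟩
  intro x y z hx hy hz hxy hxz
  have h1 := hmoved x hx
  have h2 := hmoved y hy
  have h3 := hmoved z hz
  have e : ∀ w, φ w ^ 2 + 282 * φ w - 34 = 0 → x ≠ w → φ x + φ w + 282 = 0 := by
    intro w hw hxw
    have : (φ x - φ w) * (φ x + φ w + 282) = 0 := by linear_combination h1 - hw
    exact (mul_eq_zero.mp this).resolve_left (sub_ne_zero.mpr (fun h => hxw (hφ h)))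
  apply hφ
  linear_combination e y h2 hxy - e z h3 hxz

/-- The octavic `t⁸ + 600822t⁷ + 71378609t⁶ + 4219381768t⁵ + 85080645104t⁴
− 2272444082944t³ + 16480136388352t² − 50330309965824t + 56693912375296`
is irreducible over `ℚ` with Galois group `S₈`; in particular its roots are not
expressible by radicals. -/
theorem octavic_irreducible_galois_S8
    (p : Polynomial ℚ)
    (hp : p = X ^ 8 + C 600822 * X ^ 7 + C 71378609 * X ^ 6 + C 4219381768 * X ^ 5
      + C 85080645104 * X ^ 4 - C 2272444082944 * X ^ 3 + C 16480136388352 * X ^ 2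
      - C 50330309965824 * X + C 56693912375296) :
    Irreducible p ∧ Nonempty (p.Gal ≃* Equiv.Perm (Fin 8)) ∧
      ∀ x : ℂ, aeval x p = 0 → x ∉ solvableByRad ℚ ℂ := by
  classical
  have : Fact (Nat.Prime 5) := ⟨by norm_num⟩
  have : Fact (Nat.Prime 601) := ⟨by norm_num⟩
  have hpZ : p = fZ.map (algebraMap ℤ ℚ) := by
    rw [hp]
    simp only [fZ, Polynomial.map_add, Polynomial.map_sub, Polynomial.map_mul, Polynomial.map_pow,
      map_X, map_C]
    simp only [map_ofNat]
  have hmonic : p.Monic := hpZ ▸ fZ_monic.map _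
  have hdeg : p.natDegree = 8 := by rw [hpZ, fZ_monic.natDegree_map, fZ_deg]
  have hp0 : p ≠ 0 := hmonic.ne_zero
  have hev : ∀ {L : Type} [Field L] [Algebra ℚ L] (x : L), aeval x p = F x := by
    intro L _ _ x
    rw [hpZ, aeval_map_algebraMap, fZ_aeval]
  let K := p.SplittingField
  have : NumberField K := { to_charZero := inferInstance, to_finiteDimensional := inferInstance }
  have hfs : Fact ((p.map (algebraMap ℚ K)).Splits) := ⟨SplittingField.splits p⟩
  have sepA5 : ∀ (k : Type) [Field k] (_ : ((5 : ℕ) : k) = 0) (y : k), F y = 0 → F' y ≠ 0 :=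
    fun k _ h y hy hy' => one_ne_zero (sep5 (by exact_mod_cast h) y hy hy')
  have sepA601 : ∀ (k : Type) [Field k] (_ : ((601 : ℕ) : k) = 0) (y : k), F y = 0 → F' y ≠ 0 :=
    fun k _ h y hy hy' => one_ne_zero (sep601 (by exact_mod_cast h) y hy hy')
  have hder : ∀ {L : Type} [Field L] [Algebra ℚ L] (x : L),
      eval x (derivative (p.map (algebraMap ℚ L))) = F' x := by
    intro L _ _ x
    rw [hp]
    unfold F'
    simp only [Polynomial.map_add, Polynomial.map_sub, Polynomial.map_mul, Polynomial.map_pow,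
      map_X, map_C, derivative_add, derivative_sub, derivative_X_pow, derivative_C_mul,
      derivative_X, derivative_C, eval_add, eval_sub, eval_mul, eval_pow, eval_X, eval_C, eval_one,
      eval_zero]
    simp only [map_ofNat]
    push_cast
    ring
  have hspl : IsSplittingField ℚ K p := by
    have h := IsSplittingField.splittingField p
    convert h using 1
    exact Subsingleton.elim _ _
  have hnorm : Normal ℚ K := Normal.of_isSplittingField p
  have : IsGalois ℚ K := { to_isSeparable := inferInstance, to_normal := hnorm }
  have hsep : p.Separable := by
    rw [← nodup_aroots_iff_of_splits hp0 hfs.out, Multiset.nodup_iff_count_le_one]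
    intro x
    by_contra hcon
    push Not at hcon
    rw [aroots_def, count_roots, one_lt_rootMultiplicity_iff_isRoot
      (by rw [Polynomial.map_ne_zero_iff (algebraMap ℚ K).injective]; exact hp0)] at hcon
    obtain ⟨h1, h2⟩ := hcon
    refine deriv_ne_zero K x ?_ ((hder x).symm.trans h2)
    rw [← hev, aeval_def, ← eval_map]
    exact h1
  let Ω := p.rootSet K
  have hcard : Fintype.card Ω = 8 := by
    rw [← hdeg]; exact card_rootSet_eq_natDegree hsep hfs.out
  let H : Subgroup (Equiv.Perm Ω) := (Gal.galActionHom p K).range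
  let ρ : (K ≃ₐ[ℚ] K) → Equiv.Perm Ω := fun g => Gal.galActionHom p K (Gal.restrict p K g)
  have hρ : ∀ g (x : Ω), ((ρ g x : Ω) : K) = g x := fun g x => Gal.galActionHom_restrict p K g x
  have hρH : ∀ g, ρ g ∈ H := fun g => ⟨_, rfl⟩
  have hF : ∀ x : Ω, F (x : K) = 0 := fun x => by
    rw [← hev]; exact (mem_rootSet.mp x.2).2
  obtain ⟨x₀, σ, hσH⟩ : ∃ x₀ : Ω, ∃ σ ∈ H, σ x₀ = x₀ ∧
      ∀ s t, s ≠ x₀ → t ≠ x₀ → ∃ i : ℕ, (σ ^ i) s = t := by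
    obtain ⟨k, _, _, φ, g, h1, h2, h3⟩ := frobPerm K 5 sepA5 Ω Subtype.val Subtype.val_injective hF ρ hρ
    obtain ⟨x₀, h4, h5⟩ := perm5 hcard φ h1 h2 (ρ g) h3
    exact ⟨x₀, ρ g, hρH g, h4, h5⟩
  obtain ⟨a, b, hab, hsw⟩ : ∃ a b : Ω, a ≠ b ∧ Equiv.swap a b ∈ H := by
    obtain ⟨k, _, _, φ, g, h1, h2, h3⟩ :=
      frobPerm K 601 sepA601 Ω Subtype.val Subtype.val_injective hF ρ hρ
    obtain ⟨a, b, hab, h⟩ := perm601 hcard φ h1 h2 (ρ g) h3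
    exact ⟨a, b, hab, h ▸ hρH g⟩
  have hmove : ∃ g ∈ H, g x₀ ≠ x₀ := by
    by_contra hcon
    push Not at hcon
    have hfix : ∀ g : K ≃ₐ[ℚ] K, g (x₀ : K) = x₀ := fun g => by
      rw [← hρ, hcon _ (hρH g)]
    obtain ⟨q, hq⟩ := IntermediateField.mem_bot.mp ((IsGalois.mem_bot_iff_fixed (F := ℚ) (x₀ : K)).mpr hfix)
    have hFq : F q = 0 := by
      apply (algebraMap ℚ K).injective
      rw [map_F, hq, hF, map_zero]
    have hqi : IsIntegral ℤ q := ⟨fZ, fZ_monic, by rw [← aeval_def, fZ_aeval, hFq]⟩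
    obtain ⟨n, hn⟩ := IsIntegrallyClosed.isIntegral_iff.mp hqi
    apply no_int_root n
    apply (algebraMap ℤ ℚ).injective_int
    rw [map_F, hn, hFq, map_zero]
  obtain ⟨hT, hTop⟩ := comb_top H σ hσH.1 x₀ hσH.2.1 hσH.2.2 hmove a b hab hsw
  have hirr : Irreducible p := by
    have hint : IsIntegral ℚ (x₀ : K) := Algebra.IsIntegral.isIntegral _
    have hdvd : minpoly ℚ (x₀ : K) ∣ p := minpoly.dvd _ _ ((hev _).trans (hF x₀))
    have hsub : ∀ x : Ω, aeval (x : K) (minpoly ℚ (x₀ : K)) = 0 := by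
      intro x
      obtain ⟨τ, ⟨g, rfl⟩, hg⟩ := hT x
      obtain ⟨g, rfl⟩ := Gal.restrict_surjective p K g
      have h1 : (x : K) = g x₀ := by rw [← hg]; exact hρ g x₀
      rw [h1, ← AlgEquiv.coe_toAlgHom g, aeval_algHom_apply, minpoly.aeval, map_zero]
    have h8 : 8 ≤ (minpoly ℚ (x₀ : K)).natDegree := by
      have hle : (p.rootSet K).ncard ≤ ((minpoly ℚ (x₀ : K)).rootSet K).ncard :=
        Set.ncard_le_ncard (fun x hx => mem_rootSet.mpr ⟨minpoly.ne_zero hint, hsub ⟨x, hx⟩⟩)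
          (rootSet_finite _ _)
      have h9 := ncard_rootSet_le (minpoly ℚ (x₀ : K)) K
      have h10 : (p.rootSet K).ncard = 8 := by
        rw [← Nat.card_coe_set_eq, Nat.card_eq_fintype_card]; exact hcard
      omega
    have heq : minpoly ℚ (x₀ : K) = p :=
      (eq_of_monic_of_dvd_of_natDegree_le (minpoly.monic hint) hmonic hdvd (by omega)).symm
    rw [← heq]
    exact minpoly.irreducible hint
  have eGal : p.Gal ≃* Equiv.Perm Ω := MulEquiv.ofBijective (Gal.galActionHom p K)
    ⟨Gal.galActionHom_injective p K, MonoidHom.range_eq_top.mp hTop⟩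
  have e8 : p.Gal ≃* Equiv.Perm (Fin 8) :=
    eGal.trans (Fintype.equivFinOfCardEq hcard).permCongrHom
  refine ⟨hirr, ⟨e8⟩, fun x hx hrad => ?_⟩
  have hs : Group.IsSolvable p.Gal := isSolvable_gal_of_irreducible hrad hirr hx
  have hs8 : Group.IsSolvable (Equiv.Perm (Fin 8)) :=
    Group.isSolvable_of_surjective (f := e8.toMonoidHom) e8.surjective
  exact Equiv.Perm.not_isSolvable (Fin 8) (by simp; norm_num) hs8
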